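/- arXiv:math/0401306 — 2 statements merged into one kernel-verified Lean document; each statement's English description precedes it below -/
import Mathlib

section
/- Let (R, m) be a local Noetherian ring, J ⊆ R an ideal, and I an integrally closed m-primary ideal. If J is contained in the integral closure of m·(IJ : (I ∩ J)), then J ⊆ I. -/
/-- `x` is integral over the ideal `I`: it satisfies an equation
`x^m + b_1 x^{m-1} + ... + b_m = 0` with `b_j ∈ I^j` and `m ≥ 1`. -/
def Ideal.IsIntegralElem' {R : Type*} [CommRing R] (I : Ideal R) (x : R) : Prop :=
  ∃ m : ℕ, 0 < m ∧ ∃ b : ℕ → R, (∀ j, 1 ≤ j → j ≤ m → b j ∈ I ^ j) ∧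
    x ^ m + ∑ j ∈ Finset.Icc 1 m, b j * x ^ (m - j) = 0

/-- The integral closure of an ideal, as an ideal.  (Since the set of elements integral
over `I` is an ideal, taking the span adds nothing.) -/
def Ideal.intClosure {R : Type*} [CommRing R] (I : Ideal R) : Ideal R :=
  Ideal.span {x | I.IsIntegralElem' x}

/-- An ideal is integrally closed if it contains every element integral over it. -/
def Ideal.IsIntClosed {R : Type*} [CommRing R] (I : Ideal R) : Prop :=
  ∀ x, I.IsIntegralElem' x → x ∈ I

/-- The minimal number of generators of an ideal. -/
noncomputable def Ideal.mu {R : Type*} [CommRing R] (I : Ideal R) : ℕ :=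
  sInf {n | ∃ f : Fin n → R, Ideal.span (Set.range f) = I}

namespace Ideal

variable {R : Type*} [CommRing R]

theorem IsIntegralElem'.mono {A B : Ideal R} (hAB : A ≤ B) {x : R}
    (hx : A.IsIntegralElem' x) : B.IsIntegralElem' x := by
  obtain ⟨m, hm, b, hb, h⟩ := hx
  exact ⟨m, hm, b, fun j h1 h2 => Ideal.pow_right_mono hAB j (hb j h1 h2), h⟩

theorem sup_pow_succ_le (A B : Ideal R) (n : ℕ) :
    (A ⊔ B) ^ (n + 1) ≤ A * (A ⊔ B) ^ n ⊔ B ^ (n + 1) := by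
  induction n with
  | zero => simp
  | succ n ih =>
    calc (A ⊔ B) ^ (n + 1 + 1) = A * (A ⊔ B) ^ (n + 1) ⊔ B * (A ⊔ B) ^ (n + 1) := by
          rw [pow_succ' (A ⊔ B) (n + 1), Ideal.sup_mul]
      _ ≤ A * (A ⊔ B) ^ (n + 1) ⊔ B * (A * (A ⊔ B) ^ n ⊔ B ^ (n + 1)) := by gcongr
      _ ≤ A * (A ⊔ B) ^ (n + 1) ⊔ B ^ (n + 1 + 1) := by
          rw [Ideal.mul_sup, ← pow_succ', mul_left_comm, ← sup_assoc]
          refine sup_le_sup_right (sup_le le_rfl (Ideal.mul_mono_right ?_)) _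
          rw [pow_succ' (A ⊔ B) n]
          exact Ideal.mul_mono_left le_sup_right

/-- An ideal is a reduction of the ideal obtained by adjoining an element integral over it. -/
theorem IsIntegralElem'.exists_pow_le {A : Ideal R} {y : R} (hy : A.IsIntegralElem' y) :
    ∃ n : ℕ, (A ⊔ span {y}) ^ (n + 1) ≤ A * (A ⊔ span {y}) ^ n := by
  obtain ⟨m, hm, b, hb, h⟩ := hy
  obtain ⟨n, rfl⟩ : ∃ n, m = n + 1 := ⟨m - 1, by omega⟩
  refine ⟨n, (sup_pow_succ_le A (span {y}) n).trans (sup_le le_rfl ?_)⟩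
  rw [Ideal.span_singleton_pow, Ideal.span_singleton_le_iff_mem, eq_neg_of_add_eq_zero_left h]
  refine neg_mem (Ideal.sum_mem _ fun j hj => ?_)
  obtain ⟨h1, h2⟩ := Finset.mem_Icc.mp hj
  obtain ⟨k, rfl⟩ : ∃ k, j = k + 1 := ⟨j - 1, by omega⟩
  have hle : A ^ (k + 1) * (A ⊔ span {y}) ^ (n - k) ≤ A * (A ⊔ span {y}) ^ n := by
    have hn : (A ⊔ span {y}) ^ n = (A ⊔ span {y}) ^ k * (A ⊔ span {y}) ^ (n - k) := by
      rw [← pow_add]; congr 1; omega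
    rw [hn, pow_succ', mul_assoc]
    gcongr
    exact le_sup_left
  refine hle (Ideal.mul_mem_mul (hb _ h1 h2) ?_)
  rw [Nat.add_sub_add_right]
  exact Ideal.pow_mem_pow (le_sup_right (a := A) (Ideal.mem_span_singleton_self y)) _

theorem pow_add_le_pow_mul_pow {B C : Ideal R} {k : ℕ} (h : C ^ (k + 1) ≤ B * C ^ k) (n : ℕ) :
    C ^ (n + k) ≤ B ^ n * C ^ k := by
  induction n with
  | zero => simp
  | succ n ih =>
    calc C ^ (n + 1 + k) = C * C ^ (n + k) := by ring
      _ ≤ C * (B ^ n * C ^ k) := by gcongr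
      _ = B ^ n * C ^ (k + 1) := by ring
      _ ≤ B ^ n * (B * C ^ k) := by gcongr
      _ = B ^ (n + 1) * C ^ k := by ring

/-- Being a reduction is transitive. -/
theorem exists_pow_le_trans {A B C : Ideal R} (hBC : B ≤ C)
    (hB : ∃ n : ℕ, B ^ (n + 1) ≤ A * B ^ n) (hC : ∃ n : ℕ, C ^ (n + 1) ≤ B * C ^ n) :
    ∃ n : ℕ, C ^ (n + 1) ≤ A * C ^ n := by
  obtain ⟨n, hn⟩ := hB
  obtain ⟨k, hk⟩ := hC
  refine ⟨n + k, ?_⟩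
  calc C ^ (n + k + 1) = C ^ (n + 1 + k) := by ring
    _ ≤ B ^ (n + 1) * C ^ k := pow_add_le_pow_mul_pow hk _
    _ ≤ A * B ^ n * C ^ k := by gcongr
    _ ≤ A * C ^ n * C ^ k := by gcongr
    _ = A * C ^ (n + k) := by ring

/-- If a finitely generated ideal `J` consists of elements integral over `A`, then `A` is a
reduction of `A ⊔ J`. -/
theorem exists_sup_pow_le_of_fg {A J : Ideal R} (hJ : J.FG) (h : ∀ x ∈ J, A.IsIntegralElem' x) :
    ∃ n : ℕ, (A ⊔ J) ^ (n + 1) ≤ A * (A ⊔ J) ^ n := by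
  classical
  obtain ⟨s, rfl⟩ := hJ
  replace h : ∀ x ∈ s, A.IsIntegralElem' x := fun x hx => h x (Ideal.subset_span hx)
  induction s using Finset.induction_on with
  | empty => exact ⟨0, by simp⟩
  | insert y s _ ih =>
    have hs := ih fun x hx => h x (Finset.mem_insert_of_mem hx)
    have hy := ((h y (Finset.mem_insert_self y s)).mono
      (le_sup_left : A ≤ A ⊔ span (s : Set R))).exists_pow_le
    have heq : A ⊔ span ((insert y s : Finset R) : Set R) =
        A ⊔ span (s : Set R) ⊔ span {y} := by
      rw [Finset.coe_insert, Ideal.span_insert, sup_assoc, sup_comm (span {y})]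
    change ∃ n : ℕ, (A ⊔ span _) ^ (n + 1) ≤ A * (A ⊔ span _) ^ n
    rw [heq]
    exact exists_pow_le_trans le_sup_left hs hy

theorem isIntegralElem'_of_monic {I : Ideal R} {x : R} {p : Polynomial R} (hp : p.Monic)
    (hpos : 0 < p.natDegree) (hcoeff : ∀ k, p.coeff k ∈ I ^ (p.natDegree - k))
    (hx : p.eval x = 0) : I.IsIntegralElem' x := by
  refine ⟨p.natDegree, hpos, fun j => p.coeff (p.natDegree - j), fun j _ hj => ?_, ?_⟩
  · simpa [Nat.sub_sub_self hj] using hcoeff (p.natDegree - j)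
  · rw [← hx]
    conv_rhs => rw [hp.as_sum]
    simp only [Polynomial.eval_add, Polynomial.eval_pow, Polynomial.eval_X,
      Polynomial.eval_finsetSum, Polynomial.eval_mul, Polynomial.eval_C, add_right_inj]
    refine Finset.sum_nbij' (p.natDegree - ·) (p.natDegree - ·) ?_ ?_ ?_ ?_ fun _ _ => rfl
    all_goals
      intro j hj
      simp only [Finset.mem_Icc, Finset.mem_range] at hj ⊢
      omega

/-- The determinant trick: if `x M ⊆ I M` for a finitely generated ideal `M` containing a power
of `x`, then `x` is integral over `I`. -/
theorem isIntegralElem'_of_mul_le {I M : Ideal R} (hM : M.FG) {x : R} {n : ℕ} (hx : x ^ n ∈ M)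
    (h : span {x} * M ≤ I * M) : I.IsIntegralElem' x := by
  cases subsingleton_or_nontrivial R
  · exact ⟨1, one_pos, 0, by simp, Subsingleton.elim _ _⟩
  have : Module.Finite R M := Module.Finite.iff_fg.mpr hM
  obtain ⟨p, hp, -, hcoeff, hzero⟩ :=
    LinearMap.exists_monic_and_natDegree_eq_and_coeff_mem_pow_and_aeval_eq_zero R
      (algebraMap R (Module.End R M) x) I (by
        rintro _ ⟨z, rfl⟩
        rw [Submodule.mem_smul_top_iff]
        exact h (Ideal.mul_mem_mul (Ideal.mem_span_singleton_self x) z.2))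
  have hpx : p.eval x * x ^ n = 0 := by
    have := congrArg Subtype.val (LinearMap.congr_fun hzero ⟨x ^ n, hx⟩)
    rw [Polynomial.aeval_algebraMap_apply] at this
    simpa using this
  have hdeg : (p * Polynomial.X ^ (n + 1)).natDegree = p.natDegree + (n + 1) :=
    Polynomial.natDegree_mul_X_pow _ hp.ne_zero
  refine isIntegralElem'_of_monic (hp.mul (Polynomial.monic_X_pow (n + 1))) (by omega)
    (fun k => ?_) (by simp [pow_succ, ← mul_assoc, hpx])
  rw [hdeg, Polynomial.coeff_mul_X_pow']
  split_ifs with hk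
  · convert hcoeff (k - (n + 1)) using 2
    omega
  · exact zero_mem _

end Ideal

open IsLocalRing in
/-- **Corollary.**  Let `(R, 𝔪)` be a local Noetherian ring, `J ⊆ R` an ideal and `I`
an integrally closed `𝔪`-primary ideal.  If `J` is contained in the integral closure of
`𝔪 (IJ : I ∩ J)`, then `J ⊆ I`. -/
theorem le_of_le_intClosure_colon
    {R : Type*} [CommRing R] [IsLocalRing R] [IsNoetherianRing R]
    (J I : Ideal R) (hintcl : I.IsIntClosed) (hprimary : I.radical = maximalIdeal R)
    (h : ∀ x ∈ J,
      (maximalIdeal R * Submodule.colon (I * J) (I ⊓ J)).IsIntegralElem' x) :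
    J ≤ I := by
  by_contra hJI
  obtain ⟨x, hxJ, hxI, hmx⟩ : ∃ x ∈ J, x ∉ I ∧ ∀ a ∈ maximalIdeal R, a * x ∈ I := by
    have hex : ∃ n : ℕ, maximalIdeal R ^ n * J ≤ I := by
      obtain ⟨n, hn⟩ := I.exists_radical_pow_le_of_fg (IsNoetherian.noetherian _)
      rw [hprimary] at hn
      exact ⟨n, Ideal.mul_le_left.trans hn⟩
    classical
    obtain ⟨n, hn⟩ : ∃ n, Nat.find hex = n + 1 :=
      Nat.exists_eq_succ_of_ne_zero fun h0 => hJI (by simpa [h0] using Nat.find_spec hex)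
    obtain ⟨x, hx, hxI⟩ := SetLike.not_le_iff_exists.mp (Nat.find_min hex (m := n) (by omega))
    refine ⟨x, Ideal.mul_le_right hx, hxI, fun a ha => Nat.find_spec hex ?_⟩
    rw [hn, pow_succ', mul_assoc]
    exact Ideal.mul_mem_mul ha hx
  refine hxI (hintcl x ?_)
  set K := maximalIdeal R * Submodule.colon (I * J) (I ⊓ J) with hK
  have hKx : Ideal.span {x} * K ≤ I * J := by
    rw [hK, ← mul_assoc, Ideal.mul_le]
    intro a ha c hc
    have hxa : a ∈ I ⊓ J := by
      refine (Ideal.mul_le.mpr ?_ : Ideal.span {x} * maximalIdeal R ≤ I ⊓ J) ha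
      intro y hy b hb
      obtain ⟨d, rfl⟩ := Ideal.mem_span_singleton'.mp hy
      rw [show d * x * b = d * (b * x) by ring]
      exact Ideal.mul_mem_left _ _ ⟨hmx b hb, J.mul_mem_left b hxJ⟩
    rw [mul_comm a c]
    exact Submodule.mem_colon.mp hc a hxa
  obtain ⟨n, hn⟩ := Ideal.exists_sup_pow_le_of_fg (IsNoetherian.noetherian J) h
  refine Ideal.isIntegralElem'_of_mul_le (M := (K ⊔ J) ^ (n + 1)) (IsNoetherian.noetherian _)
    (Ideal.pow_mem_pow (le_sup_right (a := K) hxJ) (n + 1)) ?_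
  calc Ideal.span {x} * (K ⊔ J) ^ (n + 1) ≤ Ideal.span {x} * (K * (K ⊔ J) ^ n) := by gcongr
    _ = Ideal.span {x} * K * (K ⊔ J) ^ n := by ring
    _ ≤ I * J * (K ⊔ J) ^ n := by gcongr
    _ ≤ I * (K ⊔ J) * (K ⊔ J) ^ n := by gcongr; exact le_sup_right
    _ = I * (K ⊔ J) ^ (n + 1) := by ring
end

section
/- Let (R, m) be a local Noetherian ring, I an integrally closed ideal with m ∈ Ass(R/I), and M a finitely generated R-module with minimal free resolution (F_*, φ_i). For t ≥ 1 set J_t = Ann(Tor_t^R(R/I, M)). If the image of φ_t is contained in (the integral closure of mJ_t)·F_{t-1} (e.g., if Tor_t^R(R/I, M) = 0), then either M has projective dimension less than t-1, or m ∈ Ass(Tor_{t-1}^R(R/I, M)). -/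
universe u

open CategoryTheory in
/-- `Ext^n_R(M, N)`, via the derived functor `Ext` on `ModuleCat R`. -/
noncomputable def ExtMod (R : Type u) [CommRing R] (M N : Type u)
    [AddCommGroup M] [Module R M] [AddCommGroup N] [Module R N] (n : ℕ) : Type u :=
  ((Ext R (ModuleCat.{u} R) n).obj (Opposite.op (ModuleCat.of R M))).obj (ModuleCat.of R N)

open CategoryTheory in
noncomputable instance (R : Type u) [CommRing R] (M N : Type u)
    [AddCommGroup M] [Module R M] [AddCommGroup N] [Module R N] (n : ℕ) :
    AddCommGroup (ExtMod R M N n) :=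
  inferInstanceAs (AddCommGroup
    (((Ext R (ModuleCat.{u} R) n).obj (Opposite.op (ModuleCat.of R M))).obj (ModuleCat.of R N)))

open CategoryTheory in
noncomputable instance (R : Type u) [CommRing R] (M N : Type u)
    [AddCommGroup M] [Module R M] [AddCommGroup N] [Module R N] (n : ℕ) :
    Module R (ExtMod R M N n) :=
  inferInstanceAs (Module R
    (((Ext R (ModuleCat.{u} R) n).obj (Opposite.op (ModuleCat.of R M))).obj (ModuleCat.of R N)))

/-- `M` has projective dimension at most `n`: `Ext^{n+1}(M, -)` vanishes. -/
noncomputable def HasProjDimLE (R : Type u) [CommRing R] (M : Type u)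
    [AddCommGroup M] [Module R M] (n : ℕ) : Prop :=
  ∀ (N : Type u) [AddCommGroup N] [Module R N], Subsingleton (ExtMod R M N (n + 1))

/-- `M` has projective dimension exactly `n` (in particular, finite). -/
noncomputable def ProjDimEq (R : Type u) [CommRing R] (M : Type u)
    [AddCommGroup M] [Module R M] (n : ℕ) : Prop :=
  HasProjDimLE R M n ∧ ∀ m, HasProjDimLE R M m → n ≤ m

/-- `M` has projective dimension `< n` (with the convention `pd 0 = -∞`). -/
noncomputable def ProjDimLT (R : Type u) [CommRing R] (M : Type u)
    [AddCommGroup M] [Module R M] (n : ℕ) : Prop :=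
  Subsingleton M ∨ ∃ k, n = k + 1 ∧ HasProjDimLE R M k
open CategoryTheory in
/-- `Tor^R_n(M, N)`, via the derived functor `Tor` on `ModuleCat R`. -/
noncomputable def TorMod (R : Type u) [CommRing R] (M N : Type u)
    [AddCommGroup M] [Module R M] [AddCommGroup N] [Module R N] (n : ℕ) : Type u :=
  ((Tor (ModuleCat.{u} R) n).obj (ModuleCat.of R M)).obj (ModuleCat.of R N)

open CategoryTheory in
noncomputable instance (R : Type u) [CommRing R] (M N : Type u)
    [AddCommGroup M] [Module R M] [AddCommGroup N] [Module R N] (n : ℕ) :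
    AddCommGroup (TorMod R M N n) :=
  inferInstanceAs (AddCommGroup
    (((Tor (ModuleCat.{u} R) n).obj (ModuleCat.of R M)).obj (ModuleCat.of R N)))

open CategoryTheory in
noncomputable instance (R : Type u) [CommRing R] (M N : Type u)
    [AddCommGroup M] [Module R M] [AddCommGroup N] [Module R N] (n : ℕ) :
    Module R (TorMod R M N n) :=
  inferInstanceAs (Module R
    (((Tor (ModuleCat.{u} R) n).obj (ModuleCat.of R M)).obj (ModuleCat.of R N)))
/-- A minimal free resolution `⋯ → F_2 → F_1 → F_0 → M → 0` of a module `M` over a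
local ring.  The map `F_{t+1} → F_t` is recorded as the matrix `map t`, so that the
`t`-th differential `φ_t : F_t → F_{t-1}` (for `t ≥ 1`) is `Matrix.mulVecLin (map (t-1))`.
Minimality means all entries of the matrices lie in the maximal ideal. -/
structure MinFreeRes (R : Type u) [CommRing R] [IsLocalRing R] (M : Type u)
    [AddCommGroup M] [Module R M] where
  rank : ℕ → ℕ
  map : ∀ t : ℕ, Matrix (Fin (rank t)) (Fin (rank (t + 1))) R
  aug : (Fin (rank 0) → R) →ₗ[R] M
  aug_surjective : Function.Surjective aug
  exact_zero : LinearMap.ker aug = LinearMap.range (Matrix.mulVecLin (map 0))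
  exact : ∀ t, LinearMap.ker (Matrix.mulVecLin (map t)) =
    LinearMap.range (Matrix.mulVecLin (map (t + 1)))
  minimal : ∀ t i j, map t i j ∈ IsLocalRing.maximalIdeal R

/-- An element integral over `A` has a power `x ^ m` in `A * B ^ (m - 1)` for every ideal `B`
containing `A` and `x`. -/
theorem Ideal.IsIntegralElem'.exists_pow_succ_mem {R : Type*} [CommRing R] {A B : Ideal R} {x : R}
    (hx : A.IsIntegralElem' x) (hAB : A ≤ B) (hxB : x ∈ B) :
    ∃ m : ℕ, x ^ (m + 1) ∈ A * B ^ m := by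
  obtain ⟨m, hm, b, hb, h⟩ := hx
  obtain ⟨m, rfl⟩ : ∃ k, m = k + 1 := ⟨m - 1, by omega⟩
  refine ⟨m, ?_⟩
  rw [eq_neg_of_add_eq_zero_left h]
  refine neg_mem (Ideal.sum_mem _ fun j hj => ?_)
  obtain ⟨h1, h2⟩ := Finset.mem_Icc.mp hj
  have hle : A ^ j * B ^ (m + 1 - j) ≤ A * B ^ m := by
    obtain ⟨i, rfl⟩ : ∃ i, j = i + 1 := ⟨j - 1, by omega⟩
    calc A ^ (i + 1) * B ^ (m + 1 - (i + 1)) = A * (A ^ i * B ^ (m - i)) := by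
          rw [pow_succ', mul_assoc, Nat.add_sub_add_right]
      _ ≤ A * (B ^ i * B ^ (m - i)) := by gcongr
      _ = A * B ^ m := by rw [← pow_add, Nat.add_sub_cancel' (by omega)]
  exact hle (Ideal.mul_mem_mul (hb j h1 h2) (Ideal.pow_mem_pow hxB _))

/-- If `A` is a reduction of `B` and `x` is integral over `A`, then `A` is a reduction of
`B + (x)`. -/
theorem Ideal.exists_sup_span_singleton_pow_succ_le {R : Type*} [CommRing R] {A B : Ideal R}
    (hAB : A ≤ B) {n : ℕ} (hn : B ^ (n + 1) ≤ A * B ^ n) {x : R} (hx : A.IsIntegralElem' x) :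
    ∃ N : ℕ, (B ⊔ Ideal.span {x}) ^ (N + 1) ≤ A * (B ⊔ Ideal.span {x}) ^ N := by
  set X := Ideal.span {x}
  set C := B ⊔ X
  have hBC : B ≤ C := le_sup_left
  have hXC : X ≤ C := le_sup_right
  obtain ⟨m, hm⟩ := hx.exists_pow_succ_mem (hAB.trans hBC) (hXC (Ideal.mem_span_singleton_self x))
  have hX : X ^ (m + 1) ≤ A * C ^ m := by
    rw [Ideal.span_singleton_pow, Ideal.span_singleton_le_iff_mem]
    exact hm
  refine ⟨n + m, ?_⟩
  conv_lhs => rw [show C = B + X from rfl, add_pow]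
  rw [Ideal.sum_eq_sup]
  refine Finset.sup_le fun j hj => Ideal.mul_le_left.trans ?_
  have hj' : j ≤ n + m + 1 := by simpa [Nat.lt_succ_iff] using hj
  rcases le_or_gt (n + 1) j with h | h
  · obtain ⟨i, rfl⟩ := Nat.exists_eq_add_of_le h
    calc B ^ (n + 1 + i) * X ^ (n + m + 1 - (n + 1 + i))
        = B ^ (n + 1) * (B ^ i * X ^ (m - i)) := by
          rw [pow_add, mul_assoc, show n + m + 1 - (n + 1 + i) = m - i by omega]
      _ ≤ A * C ^ n * (C ^ i * C ^ (m - i)) := by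
          gcongr
          exact hn.trans (by gcongr)
      _ = A * C ^ (n + m) := by
          rw [mul_assoc, ← pow_add, ← pow_add, show n + (i + (m - i)) = n + m by omega]
  · calc B ^ j * X ^ (n + m + 1 - j) = X ^ (m + 1) * (B ^ j * X ^ (n - j)) := by
          rw [show n + m + 1 - j = (m + 1) + (n - j) by omega, pow_add]; ring
      _ ≤ A * C ^ m * (C ^ j * C ^ (n - j)) := by gcongr
      _ = A * C ^ (n + m) := by
          rw [mul_assoc, ← pow_add, ← pow_add, show m + (j + (n - j)) = n + m by omega]

/-- In a Noetherian ring, an ideal is a reduction of its integral closure. -/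
theorem Ideal.exists_intClosure_pow_succ_le {R : Type*} [CommRing R] [IsNoetherianRing R]
    (A : Ideal R) : ∃ n : ℕ, A.intClosure ^ (n + 1) ≤ A * A.intClosure ^ n := by
  obtain ⟨s, hs, hspan⟩ := Submodule.fg_span_iff_fg_span_finset_subset
    {x | A.IsIntegralElem' x} |>.mp (IsNoetherian.noetherian A.intClosure)
  have key : ∀ s : Finset R, (∀ x ∈ s, A.IsIntegralElem' x) →
      ∃ n : ℕ, (A ⊔ Ideal.span s) ^ (n + 1) ≤ A * (A ⊔ Ideal.span s) ^ n := by
    classical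
    intro s
    induction s using Finset.induction_on with
    | empty => exact fun _ => ⟨0, by simp⟩
    | insert x s _ ih =>
      intro h
      obtain ⟨n, hn⟩ := ih fun y hy => h y (Finset.mem_insert_of_mem hy)
      have := exists_sup_span_singleton_pow_succ_le le_sup_left hn
        (h x (Finset.mem_insert_self x s))
      rwa [sup_assoc, ← Ideal.span_union, Set.union_singleton, ← Finset.coe_insert] at this
  obtain ⟨n, hn⟩ := key s hs
  have hspan : A.intClosure = Ideal.span s := hspan
  have hle : A ≤ Ideal.span s := fun a ha =>
    hspan.le <| Ideal.subset_span ⟨1, one_pos, fun _ => -a, by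
      intro j h1 h2
      obtain rfl : j = 1 := by omega
      simpa using ha, by simp⟩
  rw [sup_eq_right.mpr hle] at hn
  exact ⟨n, by rwa [hspan]⟩

/-- If `w * N ⊆ I * N` for a finitely generated ideal `N` containing a power of `w`, then `w` is
integral over `I`. -/
theorem Ideal.isIntegralElem'_of_smul_le {R : Type*} [CommRing R] {I N : Ideal R} (hN : N.FG)
    {w : R} (hw : ∀ x ∈ N, w * x ∈ I * N) {n : ℕ} (hn : w ^ (n + 1) ∈ N) :
    I.IsIntegralElem' w := by
  have : Module.Finite R N := Module.Finite.iff_fg.mpr hN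
  have hrange : LinearMap.range (algebraMap R (Module.End R N) w) ≤ I • ⊤ := by
    rintro _ ⟨x, rfl⟩
    have h : w * (x : R) ∈ (I • (⊤ : Submodule R N)).map N.subtype := by
      rw [Submodule.map_smul'', Submodule.map_top, Submodule.range_subtype]
      exact hw x x.2
    obtain ⟨y, hy, hyx⟩ := h
    rwa [show algebraMap R (Module.End R N) w x = y from Subtype.ext hyx.symm]
  obtain ⟨p, hp, -, hcoeff, haeval⟩ :=
    LinearMap.exists_monic_and_natDegree_eq_and_coeff_mem_pow_and_aeval_eq_zero R _ I hrange
  set d := p.natDegree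
  have hzero : p.eval w * w ^ (n + 1) = 0 := by
    have := congrArg Subtype.val (LinearMap.congr_fun haeval ⟨_, hn⟩)
    simpa [Polynomial.aeval_algebraMap_apply] using this
  refine ⟨d + (n + 1), by omega, fun j => if j ≤ d then p.coeff (d - j) else 0, ?_, ?_⟩
  · intro j _ _
    dsimp only
    split_ifs with h
    · simpa [Nat.sub_sub_self h] using hcoeff (d - j)
    · exact zero_mem _
  · refine Eq.trans ?_ hzero
    rw [Polynomial.eval_eq_sum_range, Finset.sum_range_succ, hp.coeff_natDegree, one_mul,
      add_mul, add_comm, ← pow_add, add_left_inj, Finset.sum_mul]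
    rw [← Finset.sum_subset (Finset.Icc_subset_Icc_right (Nat.le_add_right d (n + 1)))
      fun j hj hj' => by
        dsimp only
        rw [if_neg fun h => hj' (Finset.mem_Icc.mpr ⟨(Finset.mem_Icc.mp hj).1, h⟩), zero_mul]]
    refine Finset.sum_nbij' (d - ·) (d - ·) ?_ ?_ ?_ ?_ ?_ <;> intro j hj <;>
      simp only [Finset.mem_Icc, Finset.mem_range] at hj ⊢
    iterate 4 omega
    rw [if_pos hj.2, mul_assoc, ← pow_add, show d + (n + 1) - j = d - j + (n + 1) by omega]

/-- If `w` lies in the integral closure of `A` and `w * A ⊆ I * A⁻`, then `w` is integral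
over `I`. -/
theorem Ideal.isIntegralElem'_of_mul_le_mul_intClosure {R : Type*} [CommRing R]
    [IsNoetherianRing R] {A I : Ideal R} {w : R} (hw : w ∈ A.intClosure)
    (h : ∀ a ∈ A, w * a ∈ I * A.intClosure) : I.IsIntegralElem' w := by
  obtain ⟨n, hn⟩ := A.exists_intClosure_pow_succ_le
  refine isIntegralElem'_of_smul_le (IsNoetherian.noetherian (A.intClosure ^ (n + 1)))
    (fun x hx => ?_) (Ideal.pow_mem_pow hw (n + 1))
  have hle : Ideal.span {w} * (A * A.intClosure ^ n) ≤ I * A.intClosure ^ (n + 1) := by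
    rw [← mul_assoc, pow_succ', ← mul_assoc]
    exact Ideal.mul_mono_left (Ideal.span_singleton_mul_le_iff.mpr h)
  exact hle (Ideal.mul_mem_mul (Ideal.mem_span_singleton_self w) (hn hx))

/-- A vector lies in `I • ⊤` iff its entries lie in `I`. -/
theorem Ideal.mem_smul_top_pi_iff {R ι : Type*} [CommRing R] [Finite ι] {I : Ideal R}
    {v : ι → R} : v ∈ (I • ⊤ : Submodule R (ι → R)) ↔ ∀ i, v i ∈ I := by
  classical
  have := Fintype.ofFinite ι
  constructor
  · intro h i
    induction h using Submodule.smul_induction_on' with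
    | smul a ha w _ => exact I.mul_mem_right (w i) ha
    | add x _ y _ hx hy => exact add_mem hx hy
  · intro h
    rw [pi_eq_sum_univ' v]
    exact Submodule.sum_mem _ fun i _ => Submodule.smul_mem_smul (h i) trivial

open CategoryTheory

/-- The homology of a short complex of modules receives the classes of cycles, and a class vanishes
exactly when the cycle is a boundary. -/
theorem CategoryTheory.ShortComplex.exists_moduleCat_homologyClass {R : Type u} [CommRing R]
    (S : ShortComplex (ModuleCat.{u} R)) :
    ∃ cl : LinearMap.ker S.g.hom →ₗ[R] S.homology,
      ∀ z, cl z = 0 ↔ (z : S.X₂) ∈ LinearMap.range S.f.hom := by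
  let e : (LinearMap.ker S.g.hom ⧸ LinearMap.range S.moduleCatToCycles) ≃ₗ[R] S.homology :=
    S.moduleCatHomologyIso.symm.toLinearEquiv
  refine ⟨e.toLinearMap ∘ₗ (LinearMap.range S.moduleCatToCycles).mkQ, fun z => ?_⟩
  rw [LinearMap.comp_apply, LinearEquiv.coe_coe, e.map_eq_zero_iff, Submodule.mkQ_apply,
    Submodule.Quotient.mk_eq_zero]
  exact ⟨fun ⟨x, hx⟩ => ⟨x, congrArg Subtype.val hx⟩, fun ⟨x, hx⟩ => ⟨x, Subtype.ext hx⟩⟩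

/-- The homology of a complex of modules receives the classes of cycles, and a class vanishes
exactly when the cycle is a boundary. -/
theorem HomologicalComplex.exists_moduleCat_homologyClass {R : Type u} [CommRing R] {ι : Type*}
    {c : ComplexShape ι} (K : HomologicalComplex (ModuleCat.{u} R) c) {i j k : ι}
    (hi : c.prev j = i) (hk : c.next j = k) :
    ∃ cl : LinearMap.ker (K.d j k).hom →ₗ[R] K.homology j,
      ∀ z, cl z = 0 ↔ (z : K.X j) ∈ LinearMap.range (K.d i j).hom := by
  subst hi hk
  exact (K.sc j).exists_moduleCat_homologyClass

open scoped TensorProduct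

namespace MinFreeRes

variable {R : Type u} [CommRing R] [IsLocalRing R] {M : Type u} [AddCommGroup M] [Module R M]
  (F : MinFreeRes R M)

/-- The chain complex of a minimal free resolution. -/
noncomputable def chainComplex : ChainComplex (ModuleCat.{u} R) ℕ :=
  ChainComplex.of (fun n => ModuleCat.of R (Fin (F.rank n) → R))
    (fun n => ModuleCat.ofHom (Matrix.mulVecLin (F.map n))) fun n => by
      rw [← ModuleCat.ofHom_comp, LinearMap.range_le_ker_iff.mp (F.exact n).ge]
      rfl

theorem chainComplex_d (n : ℕ) :
    F.chainComplex.d (n + 1) n = ModuleCat.ofHom (Matrix.mulVecLin (F.map n)) := by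
  simp [chainComplex]

theorem chainComplex_exactAt_succ (n : ℕ) : F.chainComplex.ExactAt (n + 1) := by
  rw [HomologicalComplex.exactAt_iff' _ (n + 1 + 1) (n + 1) n (by simp) (by simp),
    ShortComplex.moduleCat_exact_iff_range_eq_ker]
  change LinearMap.range (F.chainComplex.d _ _).hom = LinearMap.ker (F.chainComplex.d _ _).hom
  rw [chainComplex_d, chainComplex_d]
  exact (F.exact n).symm

/-- The augmentation map of a minimal free resolution. -/
noncomputable def augmentation : F.chainComplex.X 0 ⟶ ModuleCat.of R M := ModuleCat.ofHom F.aug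

theorem chainComplex_d_augmentation : F.chainComplex.d 1 0 ≫ F.augmentation = 0 := by
  rw [chainComplex_d]
  exact ModuleCat.hom_ext (LinearMap.range_le_ker_iff.mp F.exact_zero.ge)

/-- A minimal free resolution as a projective resolution. -/
noncomputable def projectiveResolution : ProjectiveResolution (ModuleCat.of R M) where
  complex := F.chainComplex
  projective n := by
    exact (IsProjective.iff_projective (R := R) (Fin (F.rank n) → R)).mp inferInstance
  π := (ChainComplex.toSingle₀Equiv _ _).symm ⟨F.augmentation, F.chainComplex_d_augmentation⟩
  quasiIso := ⟨fun n => by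
    cases n
    · rw [ChainComplex.quasiIsoAt₀_iff, ShortComplex.quasiIso_iff_of_zeros']
      · refine ⟨?_, ?_⟩
        · rw [ShortComplex.moduleCat_exact_iff_range_eq_ker]
          change LinearMap.range (F.chainComplex.d 1 0).hom = LinearMap.ker
            (((ChainComplex.toSingle₀Equiv F.chainComplex (ModuleCat.of R M)).symm
              ⟨F.augmentation, _⟩).f 0).hom
          rw [ChainComplex.toSingle₀Equiv_symm_apply_f_zero, chainComplex_d]
          exact F.exact_zero.symm
        · rw [ModuleCat.epi_iff_surjective]
          change Function.Surjective
            (((ChainComplex.toSingle₀Equiv F.chainComplex (ModuleCat.of R M)).symm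
              ⟨F.augmentation, _⟩).f 0).hom
          rw [ChainComplex.toSingle₀Equiv_symm_apply_f_zero]
          exact F.aug_surjective
      all_goals rfl
    · rw [quasiIsoAt_iff_exactAt']
      · exact F.chainComplex_exactAt_succ _
      · exact ChainComplex.exactAt_succ_single_obj _ _⟩

/-- The module of vectors in `F_n` which become cycles in `R ⧸ I ⊗ F`. -/
def cyclesMod (I : Ideal R) : ∀ n, Submodule R (Fin (F.rank n) → R)
  | 0 => ⊤
  | n + 1 => (I • ⊤ : Submodule R (Fin (F.rank n) → R)).comap (Matrix.mulVecLin (F.map n))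

/-- Cycles modulo `I` have classes in `Tor`, vanishing exactly on the boundaries modulo `I`. -/
theorem exists_torClass (I : Ideal R) (n : ℕ) :
    ∃ cl : F.cyclesMod I n →ₗ[R] TorMod R (R ⧸ I) M n, ∀ v, cl v = 0 ↔
      (v : Fin (F.rank n) → R) ∈ LinearMap.range (Matrix.mulVecLin (F.map n)) ⊔ I • ⊤ := by
  let T := (MonoidalCategory.tensoringLeft (ModuleCat.{u} R)).obj (ModuleCat.of R (R ⧸ I))
  let K := (T.mapHomologicalComplex (ComplexShape.down ℕ)).obj F.chainComplex
  obtain ⟨cl, hcl⟩ := K.exists_moduleCat_homologyClass (ChainComplex.prev ℕ n) rfl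
  let e : K.homology n ≃ₗ[R] TorMod R (R ⧸ I) M n :=
    (F.projectiveResolution.isoLeftDerivedObj T n).symm.toLinearEquiv
  have hd (m : ℕ) : (K.d (m + 1) m).hom = (Matrix.mulVecLin (F.map m)).lTensor (R ⧸ I) := by
    change (T.map (F.chainComplex.d (m + 1) m)).hom = _
    rw [chainComplex_d]
    rfl
  have hmk (m : ℕ) (v : Fin (F.rank m) → R) :
      (1 : R ⧸ I) ⊗ₜ[R] v = 0 ↔ v ∈ (I • ⊤ : Submodule R (Fin (F.rank m) → R)) := by
    rw [← (TensorProduct.quotTensorEquivQuotSMul _ I).map_eq_zero_iff,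
      TensorProduct.quotTensorEquivQuotSMul_mk_one_tmul, Submodule.Quotient.mk_eq_zero]
  have hker (v : F.cyclesMod I n) :
      TensorProduct.mk R (R ⧸ I) (Fin (F.rank n) → R) 1 v ∈
        LinearMap.ker (K.d n ((ComplexShape.down ℕ).next n)).hom := by
    cases n with
    | zero =>
      rw [K.shape _ _ (by simp)]
      rfl
    | succ k =>
      rw [ChainComplex.next_nat_succ, hd]
      exact (hmk k _).mpr v.2
  refine ⟨e.toLinearMap ∘ₗ cl ∘ₗ
    (TensorProduct.mk R (R ⧸ I) (Fin (F.rank n) → R) 1 ∘ₗ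
      (F.cyclesMod I n).subtype).codRestrict
        (LinearMap.ker (K.d n ((ComplexShape.down ℕ).next n)).hom) hker, fun v => ?_⟩
  rw [LinearMap.comp_apply, LinearEquiv.coe_coe, e.map_eq_zero_iff, LinearMap.comp_apply]
  refine (hcl _).trans ?_
  rw [hd]
  change (1 : R ⧸ I) ⊗ₜ[R] (v : Fin (F.rank n) → R) ∈ _ ↔ _
  constructor
  · rintro ⟨x, hx⟩
    obtain ⟨y, rfl⟩ := TensorProduct.mk_surjective R _ (R ⧸ I) Ideal.Quotient.mk_surjective x
    change (1 : R ⧸ I) ⊗ₜ[R] (F.map n).mulVecLin y = _ at hx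
    rw [← sub_eq_zero, ← TensorProduct.tmul_sub, hmk, ← neg_mem_iff, neg_sub] at hx
    exact Submodule.mem_sup.mpr ⟨_, ⟨y, rfl⟩, _, hx, by abel⟩
  · intro h
    obtain ⟨_, ⟨y, rfl⟩, z, hz, hv⟩ := Submodule.mem_sup.mp h
    refine ⟨1 ⊗ₜ y, ?_⟩
    rw [← hv, TensorProduct.tmul_add, (hmk n z).mpr hz, add_zero]
    rfl

theorem projDimLT_of_rank_eq_zero {n : ℕ} (hn : F.rank n = 0) : ProjDimLT R M n := by
  have hsub : Subsingleton (Fin (F.rank n) → R) := by rw [hn]; infer_instance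
  cases n with
  | zero => exact Or.inl F.aug_surjective.subsingleton
  | succ k =>
    refine Or.inr ⟨k, rfl, fun N _ _ => ?_⟩
    refine ModuleCat.subsingleton_of_isZero (Limits.IsZero.of_iso ?_
      (F.projectiveResolution.isoExt (k + 1) (ModuleCat.of R N)))
    rw [← HomologicalComplex.exactAt_iff_isZero_homology, HomologicalComplex.exactAt_iff]
    refine ShortComplex.exact_of_isZero_X₂ _ ?_
    rw [Limits.IsZero.iff_id_eq_zero]
    ext (x : _ ⟶ _)
    have h0 : Limits.IsZero (F.chainComplex.X (k + 1)) :=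
      ModuleCat.isZero_of_subsingleton (ModuleCat.of R (Fin (F.rank (k + 1)) → R))
    obtain rfl : x = 0 := h0.eq_of_src _ _
    rfl

/-- Vectors with entries in `I : 𝔪` are cycles modulo `I`, by minimality. -/
theorem smul_mem_cyclesMod {I : Ideal R} {s : R}
    (hs : ∀ x ∈ IsLocalRing.maximalIdeal R, x * s ∈ I) (n : ℕ) (v : Fin (F.rank n) → R) : s • v ∈ F.cyclesMod I n := by
  cases n with
  | zero => trivial
  | succ n =>
    change (F.map n).mulVecLin (s • v) ∈ (I • ⊤ : Submodule R (Fin (F.rank n) → R))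
    rw [map_smul, Ideal.mem_smul_top_pi_iff]
    intro i
    rw [Pi.smul_apply, smul_eq_mul, mul_comm]
    refine hs _ ?_
    rw [Matrix.mulVecLin_apply, Matrix.mulVec, dotProduct]
    exact Ideal.sum_mem _ fun j _ => Ideal.mul_mem_right _ _ (F.minimal n i j)

/-- If `𝔪 φ(v) ⊆ I F_n` for `φ : F_{n+1} → F_n`, then `𝔪 J φ(v) ⊆ I φ(F_{n+1})`, where `J` is the
annihilator of `Tor_{n+1}(R ⧸ I, M)`. -/
theorem smul_map_mem_of_mem_mul_annihilator {I : Ideal R} {n : ℕ} {v : Fin (F.rank (n + 1)) → R}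
    (hv : ∀ x ∈ IsLocalRing.maximalIdeal R, x • (F.map n).mulVecLin v ∈
      (I • ⊤ : Submodule R (Fin (F.rank n) → R))) {a : R}
    (ha : a ∈ IsLocalRing.maximalIdeal R * Module.annihilator R (TorMod R (R ⧸ I) M (n + 1))) :
    a • (F.map n).mulVecLin v ∈ I • LinearMap.range (F.map n).mulVecLin := by
  obtain ⟨cl, hcl⟩ := F.exists_torClass I (n + 1)
  induction ha using Submodule.mul_induction_on' with
  | mem_mul_mem x hx j hj =>
    have hc : x • v ∈ F.cyclesMod I (n + 1) := by
      change (F.map n).mulVecLin (x • v) ∈ (I • ⊤ : Submodule R (Fin (F.rank n) → R))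
      rw [map_smul]
      exact hv x hx
    have h0 : cl (j • ⟨x • v, hc⟩) = 0 := by
      rw [map_smul]
      exact Module.mem_annihilator.mp hj _
    obtain ⟨y, hy, z, hz, hyz⟩ := Submodule.mem_sup.mp ((hcl _).mp h0)
    rw [← F.exact n, LinearMap.mem_ker] at hy
    have hmap := congrArg (F.map n).mulVecLin hyz
    rw [map_add, hy, zero_add] at hmap
    rw [← map_smul, mul_comm, mul_smul]
    change (F.map n).mulVecLin z = (F.map n).mulVecLin (j • x • v) at hmap
    rw [← hmap, ← Submodule.map_top, ← Submodule.map_smul'']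
    exact Submodule.mem_map_of_mem hz
  | add a _ b _ ha hb =>
    rw [add_smul]
    exact add_mem ha hb

end MinFreeRes

open IsLocalRing in
/-- **Corollary.**  Let `(R, 𝔪)` be a local (Noetherian) ring, `I` an integrally closed
ideal with `𝔪 ∈ Ass(R/I)`, `M` a finitely generated `R`-module with minimal free
resolution `(F_*, φ_*)`, and for `t ≥ 1` let `J_t = Ann (Tor_t^R(R/I, M))`.  If
`im φ_t ⊆ (𝔪J_t)⁻ F_{t-1}` (e.g. if `Tor_t^R(R/I, M) = 0`), then either `M` has
projective dimension `< t - 1`, or `𝔪 ∈ Ass (Tor_{t-1}^R(R/I, M))`. -/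
theorem projDimLT_or_maximalIdeal_mem_ass_tor
    {R : Type u} [CommRing R] [IsLocalRing R] [IsNoetherianRing R]
    (I : Ideal R) (hintcl : I.IsIntClosed)
    (hass : IsAssociatedPrime (maximalIdeal R) (R ⧸ I))
    (M : Type u) [AddCommGroup M] [Module R M] [Module.Finite R M]
    (F : MinFreeRes R M) (t : ℕ) (ht : 1 ≤ t)
    (hhyp : LinearMap.range (Matrix.mulVecLin (F.map (t - 1))) ≤
      (Ideal.intClosure
          (maximalIdeal R * Module.annihilator R (TorMod R (R ⧸ I) M t))) •
        (⊤ : Submodule R (Fin (F.rank (t - 1)) → R))) :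
    ProjDimLT R M (t - 1) ∨
      IsAssociatedPrime (maximalIdeal R) (TorMod R (R ⧸ I) M (t - 1)) := by
  obtain ⟨n, rfl⟩ : ∃ n, t = n + 1 := ⟨t - 1, by omega⟩
  simp only [Nat.add_sub_cancel] at hhyp ⊢
  obtain ⟨-, x, hx⟩ := isAssociatedPrime_iff.mp hass
  obtain ⟨s, rfl⟩ := Ideal.Quotient.mk_surjective x
  have hmem (r : R) : r ∈ maximalIdeal R ↔ r * s ∈ I := by
    rw [hx, Submodule.mem_colon_singleton, Submodule.mem_bot, ← Ideal.Quotient.eq_zero_iff_mem,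
      map_mul]
    rfl
  have hs : s ∉ I := fun h => (Ideal.ne_top_iff_one _).mp (maximalIdeal.isMaximal R).ne_top
    ((hmem 1).mpr (by rwa [one_mul]))
  rcases Nat.eq_zero_or_pos (F.rank n) with h0 | h0
  · exact Or.inl (F.projDimLT_of_rank_eq_zero h0)
  right
  obtain ⟨cl, hcl⟩ := F.exists_torClass I n
  let i : Fin (F.rank n) := ⟨0, h0⟩
  let z : F.cyclesMod I n :=
    ⟨s • Pi.single i 1, F.smul_mem_cyclesMod (fun x hx => (hmem x).mp hx) n _⟩
  have hz : ∀ x ∈ maximalIdeal R,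
      x • (z : Fin (F.rank n) → R) ∈ (I • ⊤ : Submodule R (Fin (F.rank n) → R)) := fun x hx => by
    rw [smul_smul]
    exact Submodule.smul_mem_smul ((hmem x).mp hx) trivial
  have hne : cl z ≠ 0 := by
    intro h
    obtain ⟨_, ⟨v, rfl⟩, u, hu, hvu⟩ := Submodule.mem_sup.mp ((hcl z).mp h)
    have hv : ∀ x ∈ maximalIdeal R, x • (F.map n).mulVecLin v ∈
        (I • ⊤ : Submodule R (Fin (F.rank n) → R)) := fun x hx => by
      rw [eq_sub_of_add_eq hvu, smul_sub]
      exact sub_mem (hz x hx) (Submodule.smul_mem _ x hu)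
    have hw : (F.map n).mulVecLin v i ∈ I := by
      refine hintcl _ (Ideal.isIntegralElem'_of_mul_le_mul_intClosure
        (A := maximalIdeal R * Module.annihilator R (TorMod R (R ⧸ I) M (n + 1))) ?_ ?_)
      · exact Ideal.mem_smul_top_pi_iff.mp (hhyp ⟨v, rfl⟩) i
      · intro a ha
        have := Submodule.smul_mono le_rfl hhyp (F.smul_map_mem_of_mem_mul_annihilator hv ha)
        rw [← Submodule.mul_smul] at this
        rw [mul_comm ((F.map n).mulVecLin v i)]
        exact Ideal.mem_smul_top_pi_iff.mp this i
    apply hs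
    have hi : (F.map n).mulVecLin v i + u i = s := by simpa [z] using congrFun hvu i
    exact hi ▸ add_mem hw (Ideal.mem_smul_top_pi_iff.mp hu i)
  refine isAssociatedPrime_iff.mpr ⟨inferInstance, cl z, ?_⟩
  refine (maximalIdeal.isMaximal R).eq_of_le ?_ ?_
  · rw [Ne, Submodule.colon_eq_top_iff_subset, Set.singleton_subset_iff]
    exact hne
  · intro x hx
    rw [Submodule.mem_colon_singleton, Submodule.mem_bot, ← map_smul, hcl]
    exact Submodule.mem_sup_right (hz x hx)
end
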